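/- Let A be a unital C*-algebra, U ⊆ ℝ an open set, and a : U → A a function that is differentiable at t₀ ∈ U and such that a(t) is core invertible (equivalently, dual core invertible and group invertible) for every t ∈ U. The following statements are equivalent: (i) the function t ↦ a(t)⊕ is continuous at t₀; (ii) the function t ↦ a(t)⊕ is differentiable at t₀; (iii) the function t ↦ a(t)⊖ is differentiable at t₀; (iv) the function t ↦ a(t)# is differentiable at t₀. Moreover, in this case the function t ↦ a(t)† is differentiable at t₀ and the derivative of t ↦ a(t)⊕ at t₀ equals a(t₀)⊕·a(t₀)·(a†)'(t₀)·(1 − a(t₀)·a(t₀)⊕) − a(t₀)⊕·a'(t₀)·a(t₀)⊕ + (1 − a(t₀)⊕·a(t₀))·a'(t₀)·a(t₀)†·a(t₀)⊕. -/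

import Mathlib

open scoped Classical

/-- `x` is a Moore–Penrose inverse of `a`. -/
def IsMPInv {A : Type*} [Ring A] [StarRing A] (a x : A) : Prop :=
  a * x * a = a ∧ x * a * x = x ∧ star (a * x) = a * x ∧ star (x * a) = x * a

/-- `x` is a group inverse of `a`. -/
def IsGroupInv {A : Type*} [Ring A] (a x : A) : Prop :=
  a * x * a = a ∧ x * a * x = x ∧ a * x = x * a

/-- `x` is a core inverse of `a`: `a·x·a = a`, `x·A = a·A`, `A·x = A·a*`. -/
def IsCoreInv {A : Type*} [Ring A] [StarRing A] (a x : A) : Prop :=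
  a * x * a = a ∧ (Set.range fun y => x * y) = (Set.range fun y => a * y) ∧
    (Set.range fun y => y * x) = (Set.range fun y => y * star a)

/-- `x` is a dual core inverse of `a`: `a·x·a = a`, `x·A = a*·A`, `A·x = A·a`. -/
def IsDualCoreInv {A : Type*} [Ring A] [StarRing A] (a x : A) : Prop :=
  a * x * a = a ∧ (Set.range fun y => x * y) = (Set.range fun y => star a * y) ∧
    (Set.range fun y => y * x) = (Set.range fun y => y * a)

/-- The Moore–Penrose inverse `a†` (or `0` if it does not exist). -/
noncomputable def mpInv {A : Type*} [Ring A] [StarRing A] (a : A) : A :=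
  if h : ∃ x, IsMPInv a x then h.choose else 0

/-- The group inverse `a#` (or `0` if it does not exist). -/
noncomputable def groupInv {A : Type*} [Ring A] (a : A) : A :=
  if h : ∃ x, IsGroupInv a x then h.choose else 0

/-- The core inverse `a⊕` (or `0` if it does not exist). -/
noncomputable def coreInv {A : Type*} [Ring A] [StarRing A] (a : A) : A :=
  if h : ∃ x, IsCoreInv a x then h.choose else 0

/-- The dual core inverse `a⊖` (or `0` if it does not exist). -/
noncomputable def dualCoreInv {A : Type*} [Ring A] [StarRing A] (a : A) : A :=
  if h : ∃ x, IsDualCoreInv a x then h.choose else 0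

/-- The maximal angle `ψ_a ∈ [0, π/2]` between `a·a†` and `a†·a`, defined by
`sin ψ_a = ‖a·a† − a†·a‖` (and `ψ_a = 0` when `a = 0`). -/
noncomputable def maxAngle {A : Type*} [NormedRing A] [StarRing A] (a : A) : ℝ :=
  Real.arcsin ‖a * mpInv a - mpInv a * a‖

/-- `δ(M, N)`: zero if `M = {0}`, otherwise the supremum of distances from
norm-one elements of `M` to `N`. -/
noncomputable def subDelta {E : Type*} [NormedAddCommGroup E] (M N : Set E) : ℝ :=
  if M = {0} then 0
  else sSup ((fun m => Metric.infDist m N) '' {m ∈ M | ‖m‖ = 1})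

/-- The gap `θ(M, N)` between the subspaces `M` and `N`. -/
noncomputable def subGap {E : Type*} [NormedAddCommGroup E] (M N : Set E) : ℝ :=
  max (subDelta M N) (subDelta N M)

/-- The right ideal `a·A`. -/
def rIdeal {A : Type*} [Ring A] (a : A) : Set A := Set.range fun y => a * y

/-- The left ideal `A·a`. -/
def lIdeal {A : Type*} [Ring A] (a : A) : Set A := Set.range fun y => y * a

/-- The right annihilator `a° = {x : a·x = 0}`. -/
def rAnn {A : Type*} [Ring A] (a : A) : Set A := {x | a * x = 0}

/-- The left annihilator `°a = {x : x·a = 0}`. -/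
def lAnn {A : Type*} [Ring A] (a : A) : Set A := {x | x * a = 0}

/-- For an idempotent `p` of a C⋆-algebra, the projection generating the same right ideal. -/
noncomputable def rangeProj {A : Type*} [Ring A] [StarRing A] (p : A) : A :=
  p * Ring.inverse (1 + p - star p)

section GroupInverse

variable {A : Type*} [Ring A]

theorem IsGroupInv.unique {a x y : A} (hx : IsGroupInv a x) (hy : IsGroupInv a y) : x = y := by
  obtain ⟨hx1, hx2, hx3⟩ := hx
  obtain ⟨hy1, hy2, hy3⟩ := hy
  have h1 : a * x = a * y := by
    calc a * x = a * y * a * x := by rw [hy1]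
      _ = y * a * (x * a) := by rw [hy3, mul_assoc (y * a), hx3]
      _ = y * (a * x * a) := by simp only [mul_assoc]
      _ = a * y := by rw [hx1, hy3]
  calc x = x * (a * x) := by rw [← mul_assoc, hx2]
    _ = x * a * y := by rw [h1, mul_assoc]
    _ = y * a * y := by rw [← hx3, h1, hy3]
    _ = y := hy2

theorem groupInv_eq {a g : A} (h : IsGroupInv a g) : groupInv a = g := by
  have hex : ∃ x, IsGroupInv a x := ⟨g, h⟩
  rw [groupInv, dif_pos hex]
  exact hex.choose_spec.unique h

theorem IsGroupInv.isIdempotentElem {a g : A} (h : IsGroupInv a g) :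
    IsIdempotentElem (a * g) := by
  rw [IsIdempotentElem, ← mul_assoc, h.1]

theorem IsGroupInv.sub_eq {a b g h : A} (hg : IsGroupInv a g) (hh : IsGroupInv b h) :
    g - h = -(g * (a - b) * h) + g * g * (a - b) * (1 - b * h)
      + (1 - a * g) * (a - b) * (h * h) := by
  obtain ⟨g1, g2, g3⟩ := hg
  obtain ⟨h1, h2, h3⟩ := hh
  have f1 : g * g * a = g := by rw [mul_assoc, ← g3, ← mul_assoc, g2]
  have f2 : b * (1 - b * h) = 0 := by rw [mul_sub, mul_one, h3, ← mul_assoc, h1, sub_self]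
  have f3 : (1 - a * g) * a = 0 := by rw [sub_mul, one_mul, g1, sub_self]
  have f4 : b * (h * h) = h := by rw [← mul_assoc, h3, h2]
  calc g - h = -(g * (a - b) * h) + (g * g * a * (1 - b * h) - g * g * (b * (1 - b * h)))
        + ((1 - a * g) * a * (h * h) - (1 - a * g) * (b * (h * h))) := by
          rw [f1, f2, f3, f4, g3]; noncomm_ring
    _ = _ := by noncomm_ring

end GroupInverse

section StarAlgebra

variable {A : Type*} [Ring A] [StarRing A]

theorem projection_eq_of_mul_eq {e q : A} (he : star e = e) (hq : star q = q)
    (heq : e * q = q) (hqe : q * e = e) : e = q := by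
  have h : star (q * e) = e * q := by rw [star_mul, he, hq]
  rw [← heq, ← h, hqe, he]

theorem projection_eq_of_mul_eq_left {e q : A} (he : star e = e) (hq : star q = q)
    (heq : e * q = e) (hqe : q * e = q) : e = q := by
  have h : star (q * e) = e * q := by rw [star_mul, he, hq]
  rw [← heq, ← h, hqe, hq]

theorem IsCoreInv.spec {a x : A} (h : IsCoreInv a x) :
    a * x * a = a ∧ x * a * x = x ∧ star (a * x) = a * x ∧ x * a * a = a ∧ a * x * x = x := by
  obtain ⟨h1, h2, h3⟩ := h
  obtain ⟨y, hy⟩ : x ∈ Set.range fun y => a * y := h2 ▸ ⟨1, mul_one x⟩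
  obtain ⟨z, hz⟩ : a ∈ Set.range fun y => x * y := h2 ▸ ⟨1, mul_one a⟩
  obtain ⟨w, hw⟩ : x ∈ Set.range fun y => y * star a := h3 ▸ ⟨1, one_mul x⟩
  dsimp only at hy hz hw
  have hx : a * x * x = x := by grind
  have hs : x * star (a * x) = x := by
    have h4 : star a * (star x * star a) = star a := by
      rw [← star_mul, ← star_mul, h1]
    rw [star_mul]
    grind
  have hsa : star (a * x) = a * x := by
    have h4 : a * x * star (a * x) = a * x := by rw [mul_assoc, hs]
    rw [← h4, star_mul, star_star]
  have hxax : x * a * x = x := by rw [mul_assoc, ← hsa, hs]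
  exact ⟨h1, hxax, hsa, by grind, hx⟩

theorem IsDualCoreInv.spec {a x : A} (h : IsDualCoreInv a x) :
    a * x * a = a ∧ x * a * x = x ∧ star (x * a) = x * a ∧ a * a * x = a ∧ x * x * a = x := by
  obtain ⟨h1, h2, h3⟩ := h
  obtain ⟨y, hy⟩ : x ∈ Set.range fun y => y * a := h3 ▸ ⟨1, one_mul x⟩
  obtain ⟨z, hz⟩ : a ∈ Set.range fun y => y * x := h3 ▸ ⟨1, one_mul a⟩
  obtain ⟨w, hw⟩ : x ∈ Set.range fun y => star a * y := h2 ▸ ⟨1, mul_one x⟩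
  dsimp only at hy hz hw
  have hx : x * x * a = x := by grind
  have ha (hxax : x * a * x = x) : a * a * x = a := by grind
  have hs : star (x * a) * x = x := by
    have h4 : star a * (star x * star a) = star a := by
      rw [← star_mul, ← star_mul, h1]
    rw [star_mul]
    grind
  have hsa : star (x * a) = x * a := by
    have h4 : star (x * a) * (x * a) = x * a := by rw [← mul_assoc, hs]
    rw [← h4, star_mul, star_star]
  have hxax : x * a * x = x := by rw [← hsa, hs]
  exact ⟨h1, hxax, hsa, ha hxax, hx⟩

theorem IsCoreInv.isGroupInv {a x : A} (h : IsCoreInv a x) : IsGroupInv a (x * x * a) := by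
  obtain ⟨h1, h2, h3, h4, h5⟩ := h.spec
  refine ⟨?_, ?_, ?_⟩ <;> grind

theorem IsDualCoreInv.isGroupInv {a x : A} (h : IsDualCoreInv a x) :
    IsGroupInv a (a * x * x) := by
  obtain ⟨h1, h2, h3, h4, h5⟩ := h.spec
  refine ⟨?_, ?_, ?_⟩ <;> grind

theorem coreInv_spec {a : A} (h : ∃ x, IsCoreInv a x) : IsCoreInv a (coreInv a) := by
  rw [coreInv, dif_pos h]
  exact h.choose_spec

theorem dualCoreInv_spec {a : A} (h : ∃ x, IsDualCoreInv a x) :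
    IsDualCoreInv a (dualCoreInv a) := by
  rw [dualCoreInv, dif_pos h]
  exact h.choose_spec

theorem mpInv_spec {a : A} (h : ∃ x, IsMPInv a x) : IsMPInv a (mpInv a) := by
  rw [mpInv, dif_pos h]
  exact h.choose_spec

theorem rangeProj_spec {p : A} (hp : IsIdempotentElem p) (hu : IsUnit (1 + p - star p)) :
    star (rangeProj p) = rangeProj p ∧ p * rangeProj p = rangeProj p ∧
      rangeProj p * p = p := by
  have hp' : p * p = p := hp
  have hps : star p * star p = star p := by rw [← star_mul, hp']
  obtain ⟨u, hu⟩ := hu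
  have hs : star (u : A) = 1 + star p - p := by
    rw [hu, star_sub, star_add, star_one, star_star]
  have hq : rangeProj p = p * ((u⁻¹ : Aˣ) : A) := by
    rw [rangeProj, ← hu, Ring.inverse_unit]
  have hu1 : ((u⁻¹ : Aˣ) : A) * u = 1 := u.inv_mul
  have hu2 : (u : A) * ((u⁻¹ : Aˣ) : A) = 1 := u.mul_inv
  have hu3 : star (u : A) * star ((u⁻¹ : Aˣ) : A) = 1 := by rw [← star_mul, hu1, star_one]
  have hu4 : star ((u⁻¹ : Aˣ) : A) * star (u : A) = 1 := by rw [← star_mul, hu2, star_one]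
  have hsa : star (rangeProj p) = rangeProj p := by
    have h1 : star (u : A) * p = star p * u := by
      rw [hs, hu, sub_mul, add_mul, mul_sub, mul_add, hp', hps]; noncomm_ring
    rw [hq, star_mul]
    calc star ((u⁻¹ : Aˣ) : A) * star p
        = star ((u⁻¹ : Aˣ) : A) * (star p * u) * ((u⁻¹ : Aˣ) : A) := by
          rw [mul_assoc, mul_assoc (star p), hu2, mul_one]
      _ = p * ((u⁻¹ : Aˣ) : A) := by
        rw [← h1, ← mul_assoc, hu4, one_mul]
  have hpq : p * rangeProj p = rangeProj p := by rw [hq, ← mul_assoc, hp']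
  refine ⟨hsa, hpq, ?_⟩
  have hqs : rangeProj p * star p = rangeProj p := by
    have := congrArg star hpq
    rwa [star_mul, hsa] at this
  have hqu : rangeProj p * u = p := by rw [hq, mul_assoc, hu1, mul_one]
  rw [hu, mul_sub, mul_add, mul_one, hqs] at hqu
  simpa using hqu

end StarAlgebra

section CStar

variable {A : Type*} [NormedRing A] [StarRing A] [CStarRing A] [CompleteSpace A]
  [NormedAlgebra ℂ A] [StarModule ℂ A]

theorem isUnit_one_add_sub_star (p : A) : IsUnit (1 + p - star p) := by
  let : CStarAlgebra A := {}
  have hsa : IsSelfAdjoint (Complex.I • (p - star p)) := by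
    rw [IsSelfAdjoint, star_smul, star_sub, star_star, RCLike.star_def, Complex.conj_I,
      neg_smul, ← smul_neg, neg_sub]
  have hn : -Complex.I ∉ spectrum ℂ (Complex.I • (p - star p)) := fun h => by
    have := hsa.im_eq_zero_of_mem_spectrum h
    simp at this
  rw [spectrum.notMem_iff] at hn
  have h := hn.smul (Units.mk0 Complex.I Complex.I_ne_zero)
  convert h using 1
  rw [Units.smul_mk0, Algebra.algebraMap_eq_smul_one, smul_sub, smul_smul, smul_smul]
  simp only [Complex.I_mul_I, mul_neg, neg_neg, one_smul, neg_smul]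
  abel

theorem rangeProj_spec_of_isIdempotentElem {p : A} (hp : IsIdempotentElem p) :
    star (rangeProj p) = rangeProj p ∧ p * rangeProj p = rangeProj p ∧
      rangeProj p * p = p :=
  rangeProj_spec hp (isUnit_one_add_sub_star p)

theorem rangeProj_star_spec {p : A} (hp : IsIdempotentElem p) :
    star (rangeProj (star p)) = rangeProj (star p) ∧
      rangeProj (star p) * p = rangeProj (star p) ∧ p * rangeProj (star p) = p := by
  have hp' : IsIdempotentElem (star p) := by
    rw [IsIdempotentElem, ← star_mul, hp.eq]
  obtain ⟨h1, h2, h3⟩ := rangeProj_spec_of_isIdempotentElem hp'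
  refine ⟨h1, ?_, ?_⟩
  · simpa [h1] using congrArg star h2
  · simpa [h1] using congrArg star h3

theorem IsGroupInv.coreInv_eq {a g : A} (hg : IsGroupInv a g) (h : ∃ x, IsCoreInv a x) :
    coreInv a = g * rangeProj (a * g) := by
  obtain ⟨h1, h2, h3, h4, h5⟩ := (coreInv_spec h).spec
  obtain ⟨q1, q2, q3⟩ := rangeProj_spec_of_isIdempotentElem hg.isIdempotentElem
  obtain ⟨g1, g2, g3⟩ := hg
  generalize coreInv a = x at *
  have hq : a * x = rangeProj (a * g) := by
    apply projection_eq_of_mul_eq h3 q1 <;> grind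
  have hgaa : g * a * a = a := by rw [← g3, g1]
  rw [← hq]
  calc x = g * a * a * x * x := by rw [hgaa, h5]
    _ = g * a * (a * x * x) := by simp only [mul_assoc]
    _ = g * (a * x) := by rw [h5, mul_assoc]

theorem IsGroupInv.isMPInv {a g : A} (hg : IsGroupInv a g) :
    IsMPInv a (rangeProj (star (a * g)) * g * rangeProj (a * g)) := by
  obtain ⟨q1, q2, q3⟩ := rangeProj_spec_of_isIdempotentElem hg.isIdempotentElem
  obtain ⟨e1, e2, e3⟩ := rangeProj_star_spec hg.isIdempotentElem
  obtain ⟨g1, g2, g3⟩ := hg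
  generalize rangeProj (star (a * g)) = e at *
  generalize rangeProj (a * g) = q at *
  have hl : a * (e * g * q) = q := by grind
  have hr : e * g * q * a = e := by grind
  refine ⟨?_, ?_, by rw [hl, q1], by rw [hr, e1]⟩ <;> grind

theorem IsGroupInv.mpInv_eq {a g : A} (hg : IsGroupInv a g) :
    mpInv a = rangeProj (star (a * g)) * g * rangeProj (a * g) := by
  obtain ⟨m1, m2, m3, m4⟩ := mpInv_spec ⟨_, hg.isMPInv⟩
  obtain ⟨q1, q2, q3⟩ := rangeProj_spec_of_isIdempotentElem hg.isIdempotentElem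
  obtain ⟨e1, e2, e3⟩ := rangeProj_star_spec hg.isIdempotentElem
  obtain ⟨g1, g2, g3⟩ := hg
  generalize mpInv a = m at *
  have hq : a * m = rangeProj (a * g) := by
    apply projection_eq_of_mul_eq m3 q1 <;> grind
  have he : rangeProj (star (a * g)) = m * a := by
    clear hq
    generalize rangeProj (star (a * g)) = e at *
    have hp : a * g * (m * a) = a * g := by rw [g3, mul_assoc, ← mul_assoc a, m1]
    apply projection_eq_of_mul_eq_left e1 m4
    · rw [← e2, mul_assoc, hp]
    · calc m * a * e = m * (a * g * a) * e := by rw [g1]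
        _ = m * a * (a * g * e) := by rw [mul_assoc a, ← g3]; simp only [mul_assoc]
        _ = m * (a * g * a) := by rw [e3, mul_assoc a, ← g3]; simp only [mul_assoc]
        _ = m * a := by rw [g1]
  rw [← hq, he]
  calc m = m * (a * g * a) * m := by rw [g1, m2]
    _ = m * a * g * (a * m) := by simp only [mul_assoc]

theorem IsGroupInv.exists_isDualCoreInv {a g : A} (hg : IsGroupInv a g) :
    ∃ x, IsDualCoreInv a x := by
  obtain ⟨e1, e2, e3⟩ := rangeProj_star_spec hg.isIdempotentElem
  obtain ⟨m1, m2, m3, m4⟩ := hg.isMPInv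
  obtain ⟨g1, g2, g3⟩ := hg
  generalize rangeProj (star (a * g)) * g * rangeProj (a * g) = m at *
  have hm : star a * star m = m * a := by rw [← star_mul, m4]
  have hs : m * a * star a = star a := by
    rw [← hm, mul_assoc, ← star_mul, ← star_mul, m1]
  refine ⟨m * a * g, by grind, ?_, ?_⟩
  · apply Set.Subset.antisymm
    · rintro _ ⟨y, rfl⟩
      exact ⟨star m * (g * y), by grind⟩
    · rintro _ ⟨y, rfl⟩
      exact ⟨a * (star a * y), by grind⟩
  · apply Set.Subset.antisymm
    · rintro _ ⟨y, rfl⟩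
      exact ⟨y * (m * g * a * g), by grind⟩
    · rintro _ ⟨y, rfl⟩
      exact ⟨y * (a * a), by grind⟩

theorem IsGroupInv.dualCoreInv_eq {a g : A} (hg : IsGroupInv a g) :
    dualCoreInv a = rangeProj (star (a * g)) * g := by
  obtain ⟨h1, h2, h3, h4, h5⟩ := (dualCoreInv_spec hg.exists_isDualCoreInv).spec
  obtain ⟨e1, e2, e3⟩ := rangeProj_star_spec hg.isIdempotentElem
  obtain ⟨g1, g2, g3⟩ := hg
  generalize dualCoreInv a = x at *
  have he : rangeProj (star (a * g)) = x * a := by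
    generalize rangeProj (star (a * g)) = e at *
    have hp : a * g * (x * a) = a * g := by rw [g3, mul_assoc, ← mul_assoc a, h1]
    apply projection_eq_of_mul_eq_left e1 h3
    · rw [← e2, mul_assoc, hp]
    · calc x * a * e = x * (a * g * a) * e := by rw [g1]
        _ = x * a * (a * g * e) := by rw [mul_assoc a, ← g3]; simp only [mul_assoc]
        _ = x * (a * g * a) := by rw [e3, mul_assoc a, ← g3]; simp only [mul_assoc]
        _ = x * a := by rw [g1]
  have hag : a * g = a * x := by
    calc a * g = g * (a * a * x) := by rw [h4, g3]
      _ = a * g * a * x := by rw [g3]; simp only [mul_assoc]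
      _ = a * x := by rw [g1]
  rw [he, mul_assoc, hag, ← mul_assoc, h2]

theorem DifferentiableAt.rangeProj {f : ℝ → A} {t : ℝ} (hf : DifferentiableAt ℝ f t) :
    DifferentiableAt ℝ (fun s => rangeProj (f s)) t := by
  have h : DifferentiableAt ℝ (fun s => 1 + f s - star (f s)) t :=
    (hf.const_add 1).sub hf.star
  have h' : DifferentiableAt ℝ (Ring.inverse ∘ fun s => 1 + f s - star (f s)) t :=
    (differentiableAt_inverse (isUnit_one_add_sub_star (f t))).comp t h
  exact hf.mul h'

end CStar

theorem differentiableAt_of_isGroupInv {A : Type*} [NormedRing A] [NormedAlgebra ℝ A]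
    {f g : ℝ → A} {t₀ : ℝ} (hf : DifferentiableAt ℝ f t₀)
    (hg : ContinuousAt g t₀) (h : ∀ᶠ t in nhds t₀, IsGroupInv (f t) (g t)) :
    DifferentiableAt ℝ g t₀ := by
  have h₀ : IsGroupInv (f t₀) (g t₀) := h.self_of_nhds
  have hs := hasDerivAt_iff_tendsto_slope.1 hf.hasDerivAt
  have hg' : Filter.Tendsto g (nhdsWithin t₀ {t₀}ᶜ) (nhds (g t₀)) :=
    hg.tendsto.mono_left nhdsWithin_le_nhds
  have hf' : Filter.Tendsto f (nhdsWithin t₀ {t₀}ᶜ) (nhds (f t₀)) :=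
    hf.continuousAt.tendsto.mono_left nhdsWithin_le_nhds
  refine (hasDerivAt_iff_tendsto_slope.2 (Filter.Tendsto.congr' ?_
    ((((hg'.mul hs).mul_const (g t₀)).neg.add
      (((hg'.mul hg').mul hs).mul_const (1 - f t₀ * g t₀))).add
      (((hf'.mul hg').const_sub 1).mul hs |>.mul_const (g t₀ * g t₀))))).differentiableAt
  filter_upwards [h.filter_mono nhdsWithin_le_nhds] with t ht
  simp only [slope_def_module]
  rw [ht.sub_eq h₀]
  simp only [smul_add, smul_neg, smul_mul_assoc, mul_smul_comm]

theorem derivative_coreInv_eq {A : Type*} [NormedRing A] [StarRing A]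
    [NormedAlgebra ℝ A] {f x m : ℝ → A} {t₀ : ℝ} {d x' m' : A}
    (hf : HasDerivAt f d t₀) (hx : HasDerivAt x x' t₀) (hm : HasDerivAt m m' t₀)
    (h : ∀ᶠ t in nhds t₀, IsCoreInv (f t) (x t) ∧ IsMPInv (f t) (m t)) :
    x' = x t₀ * f t₀ * m' * (1 - f t₀ * x t₀) - x t₀ * d * x t₀
      + (1 - x t₀ * f t₀) * d * m t₀ * x t₀ := by
  have key {a x m : A} (hx : IsCoreInv a x) (hm : IsMPInv a m) : a * m = a * x := by
    obtain ⟨h1, h2, h3, h4, h5⟩ := hx.spec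
    obtain ⟨m1, m2, m3, m4⟩ := hm
    apply projection_eq_of_mul_eq m3 h3 <;> grind
  have E1 : x' * f t₀ * m t₀ + x t₀ * d * m t₀ + x t₀ * f t₀ * m' = x' := by
    have h1 := ((hx.mul hf).mul hm).congr_of_eventuallyEq (f₁ := x) <| by
      filter_upwards [h] with t ht
      simp only [Pi.mul_apply]
      rw [mul_assoc, key ht.1 ht.2, ← mul_assoc, ht.1.spec.2.1]
    have h2 := h1.unique hx
    simp only [Pi.mul_apply] at h2
    rwa [add_mul] at h2
  have E2 : x' * f t₀ * f t₀ + x t₀ * d * f t₀ + x t₀ * f t₀ * d = d := by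
    have h1 := ((hx.mul hf).mul hf).congr_of_eventuallyEq (f₁ := f) <| by
      filter_upwards [h] with t ht
      simp only [Pi.mul_apply]
      rw [ht.1.spec.2.2.2.1]
    have h2 := h1.unique hf
    simp only [Pi.mul_apply] at h2
    rwa [add_mul] at h2
  obtain ⟨hc, hmp⟩ := h.self_of_nhds
  have hk := key hc hmp
  obtain ⟨h1, h2, h3, h4, h5⟩ := hc.spec
  obtain ⟨m1, m2, m3, m4⟩ := hmp
  generalize x t₀ = x at *
  generalize f t₀ = a at *
  generalize m t₀ = m at *
  have hma : m * (1 - a * x) = 0 := by rw [mul_sub, mul_one, ← hk, ← mul_assoc, m2, sub_self]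
  have F1 : x * a * m' * (1 - a * x) = x' - x' * a * x := by
    have : x * a * m' = x' - x' * a * m - x * d * m := by
      rw [sub_sub]
      exact eq_sub_of_add_eq' E1
    calc x * a * m' * (1 - a * x)
        = x' - x' * (a * x) - x' * a * (m * (1 - a * x)) - x * d * (m * (1 - a * x)) := by
          rw [this]; noncomm_ring
      _ = x' - x' * a * x := by rw [hma]; noncomm_ring
  have F2 : (1 - x * a) * d * m * x = x' * a * x + x * d * x := by
    have : (1 - x * a) * d = x' * a * a + x * d * a := by
      rw [sub_mul, one_mul]
      exact sub_eq_of_eq_add E2.symm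
    calc (1 - x * a) * d * m * x = x' * a * (a * m * x) + x * d * (a * m * x) := by
          rw [this]; noncomm_ring
      _ = x' * a * x + x * d * x := by rw [hk, h5]
  rw [F1, F2]
  abel

theorem stmt19 {A : Type*} [NormedRing A] [StarRing A] [CStarRing A]
    [CompleteSpace A] [NormedAlgebra ℂ A] [StarModule ℂ A]
    (U : Set ℝ) (hU : IsOpen U) (t₀ : ℝ) (ht₀ : t₀ ∈ U)
    (f : ℝ → A) (d : A) (hd : HasDerivAt f d t₀)
    (hf : ∀ t ∈ U, ∃ x, IsCoreInv (f t) x) :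
    (ContinuousAt (fun t => coreInv (f t)) t₀ ↔
       DifferentiableAt ℝ (fun t => coreInv (f t)) t₀) ∧
    (ContinuousAt (fun t => coreInv (f t)) t₀ ↔
       DifferentiableAt ℝ (fun t => dualCoreInv (f t)) t₀) ∧
    (ContinuousAt (fun t => coreInv (f t)) t₀ ↔
       DifferentiableAt ℝ (fun t => groupInv (f t)) t₀) ∧
    (ContinuousAt (fun t => coreInv (f t)) t₀ →
      DifferentiableAt ℝ (fun t => mpInv (f t)) t₀ ∧
      deriv (fun t => coreInv (f t)) t₀ =
        coreInv (f t₀) * f t₀ * deriv (fun t => mpInv (f t)) t₀ *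
            (1 - f t₀ * coreInv (f t₀)) -
          coreInv (f t₀) * d * coreInv (f t₀) +
          (1 - coreInv (f t₀) * f t₀) * d * mpInv (f t₀) * coreInv (f t₀)) := by
  have hUn : ∀ᶠ t in nhds t₀, t ∈ U := hU.mem_nhds ht₀
  have hgi {t : ℝ} (ht : t ∈ U) : IsGroupInv (f t) (groupInv (f t)) := by
    obtain ⟨x, hx⟩ := hf t ht
    rw [groupInv_eq hx.isGroupInv]
    exact hx.isGroupInv
  have hfd : DifferentiableAt ℝ f t₀ := hd.differentiableAt
  have hgp (hg : DifferentiableAt ℝ (fun t => groupInv (f t)) t₀) :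
      DifferentiableAt ℝ (fun t => rangeProj (f t * groupInv (f t))) t₀ ∧
        DifferentiableAt ℝ (fun t => rangeProj (star (f t * groupInv (f t)))) t₀ :=
    ⟨(hfd.mul hg).rangeProj, (hfd.mul hg).star.rangeProj⟩
  have hcg (hc : ContinuousAt (fun t => coreInv (f t)) t₀) :
      DifferentiableAt ℝ (fun t => groupInv (f t)) t₀ := by
    refine differentiableAt_of_isGroupInv hfd ?_ (hUn.mono fun t ht => hgi ht)
    refine ((hc.mul hc).mul hfd.continuousAt).congr ?_
    filter_upwards [hUn] with t ht
    exact (groupInv_eq (coreInv_spec (hf t ht)).isGroupInv).symm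
  have hgc (hg : DifferentiableAt ℝ (fun t => groupInv (f t)) t₀) :
      DifferentiableAt ℝ (fun t => coreInv (f t)) t₀ := by
    refine (hg.mul (hgp hg).1).congr_of_eventuallyEq ?_
    filter_upwards [hUn] with t ht
    exact (hgi ht).coreInv_eq (hf t ht)
  have hgd (hg : DifferentiableAt ℝ (fun t => groupInv (f t)) t₀) :
      DifferentiableAt ℝ (fun t => dualCoreInv (f t)) t₀ := by
    refine ((hgp hg).2.mul hg).congr_of_eventuallyEq ?_
    filter_upwards [hUn] with t ht
    exact (hgi ht).dualCoreInv_eq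
  have hdg (hc : DifferentiableAt ℝ (fun t => dualCoreInv (f t)) t₀) :
      DifferentiableAt ℝ (fun t => groupInv (f t)) t₀ := by
    refine ((hfd.mul hc).mul hc).congr_of_eventuallyEq ?_
    filter_upwards [hUn] with t ht
    exact groupInv_eq (dualCoreInv_spec (hgi ht).exists_isDualCoreInv).isGroupInv
  have hgm (hg : DifferentiableAt ℝ (fun t => groupInv (f t)) t₀) :
      DifferentiableAt ℝ (fun t => mpInv (f t)) t₀ := by
    refine (((hgp hg).2.mul hg).mul (hgp hg).1).congr_of_eventuallyEq ?_
    filter_upwards [hUn] with t ht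
    exact (hgi ht).mpInv_eq
  refine ⟨⟨fun h => hgc (hcg h), fun h => h.continuousAt⟩,
    ⟨fun h => hgd (hcg h), fun h => (hgc (hdg h)).continuousAt⟩,
    ⟨hcg, fun h => (hgc h).continuousAt⟩, fun h => ⟨hgm (hcg h), ?_⟩⟩
  refine derivative_coreInv_eq hd (hgc (hcg h)).hasDerivAt (hgm (hcg h)).hasDerivAt ?_
  filter_upwards [hUn] with t ht
  exact ⟨coreInv_spec (hf t ht), mpInv_spec ⟨_, (hgi ht).isMPInv⟩⟩
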